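/- For every L > 0, T > 0, t ∈ (0,T] and x, y ∈ [0,L], the series Σ_{n ∈ ℤ} [ p(t, x − y − 2nL) + p(t, x + y − 2nL) ] defining g(t,x,y) converges absolutely, and there exists a constant C_T > 0 (depending only on T and L) such that g(t,x,y) ≤ C_T · (4πt)^(−1/2) · exp(−(x−y)²/(4t)) for all t ∈ (0,T] and x, y ∈ [0,L]. -/

import Mathlib

open MeasureTheory Real Set

/-- The one-dimensional heat kernel `p(t,x) = (4πt)^(−1/2) · exp(−x²/(4t))`. -/
noncomputable def heatKernel (t x : ℝ) : ℝ :=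
  (Real.sqrt (4 * Real.pi * t))⁻¹ * Real.exp (-(x ^ 2) / (4 * t))

/-- The Green's function of the heat equation on `[0,L]` with Neumann boundary
conditions: `g(t,x,y) = Σ_{n ∈ ℤ} [p(t, x − y − 2nL) + p(t, x + y − 2nL)]`. -/
noncomputable def greenNeumann (L t x y : ℝ) : ℝ :=
  ∑' n : ℤ, (heatKernel t (x - y - 2 * (n : ℝ) * L) + heatKernel t (x + y - 2 * (n : ℝ) * L))

/-- A gap of at least `4 L² d` between squared arguments gains the factor `exp(-L²/T) ^ d`
in the heat kernel, uniformly in `t ∈ (0,T]`. -/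
theorem heatKernel_le_mul_pow {L T t u w : ℝ} {d : ℕ} (ht : 0 < t) (htT : t ≤ T)
    (h : u ^ 2 + 4 * L ^ 2 * d ≤ w ^ 2) :
    heatKernel t w ≤ heatKernel t u * Real.exp (-(L ^ 2 / T)) ^ d := by
  unfold heatKernel
  rw [mul_assoc (Real.sqrt _)⁻¹, ← Real.exp_nat_mul, ← Real.exp_add]
  gcongr
  have hLt : L ^ 2 / T ≤ L ^ 2 / t := by gcongr
  have hd : (d : ℝ) * (L ^ 2 / T) ≤ d * (L ^ 2 / t) := by gcongr
  have hw : -w ^ 2 / (4 * t) ≤ -u ^ 2 / (4 * t) - d * (L ^ 2 / t) := by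
    rw [show -u ^ 2 / (4 * t) - d * (L ^ 2 / t) = (-u ^ 2 - 4 * L ^ 2 * d) / (4 * t) by
      field_simp]
    gcongr
    linarith
  linarith

theorem heatKernel_nonneg (t x : ℝ) : 0 ≤ heatKernel t x := by
  unfold heatKernel
  positivity

theorem Int.eq_zero_or_eq_succ_or_eq_neg_succ (n : ℤ) :
    n = 0 ∨ (∃ k : ℕ, n = k + 1) ∨ ∃ k : ℕ, n = -(k + 1) := by
  rcases lt_trichotomy n 0 with h | h | h
  · exact Or.inr (Or.inr ⟨(-n - 1).toNat, by omega⟩)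
  · exact Or.inl h
  · exact Or.inr (Or.inl ⟨(n - 1).toNat, by omega⟩)

theorem sq_add_le_sq_sub_two_mul {L u : ℝ} (hu : |u| ≤ L) (n : ℤ) :
    u ^ 2 + 4 * L ^ 2 * (n.natAbs - 1 : ℕ) ≤ (u - 2 * n * L) ^ 2 := by
  obtain ⟨h₁, h₂⟩ := abs_le.mp hu
  have hL : 0 ≤ L := (abs_nonneg u).trans hu
  rcases n.eq_zero_or_eq_succ_or_eq_neg_succ with rfl | ⟨k, rfl⟩ | ⟨k, rfl⟩
  · simp
  · rw [show ((k : ℤ) + 1).natAbs - 1 = k by omega]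
    push_cast
    have := mul_nonneg (mul_nonneg hL (sub_nonneg.2 h₂)) (by positivity : (0 : ℝ) ≤ k + 1)
    have := sq_nonneg (k * L)
    nlinarith
  · rw [show (-((k : ℤ) + 1)).natAbs - 1 = k by omega]
    push_cast
    have := mul_nonneg (mul_nonneg hL (neg_le_iff_add_nonneg.1 h₁)) (by positivity : (0 : ℝ) ≤ k + 1)
    have := sq_nonneg (k * L)
    nlinarith

theorem sq_add_le_sq_reflect_sub_two_mul {L u s : ℝ} (hus : |u| ≤ s) (hsL : |u| ≤ 2 * L - s)
    (n : ℤ) :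
    u ^ 2 + 4 * L ^ 2 * (n.natAbs - 1 : ℕ) ≤ (s - 2 * n * L) ^ 2 := by
  have hs : 0 ≤ s := (abs_nonneg u).trans hus
  have hs' : 0 ≤ 2 * L - s := (abs_nonneg u).trans hsL
  have hL : 0 ≤ L := by linarith
  have h₁ : u ^ 2 ≤ s ^ 2 := sq_le_sq.2 (hus.trans (le_abs_self s))
  have h₂ : u ^ 2 ≤ (2 * L - s) ^ 2 := sq_le_sq.2 (hsL.trans (le_abs_self _))
  have hk (k : ℕ) : 4 * L ^ 2 * k ≤ (2 * k * L) ^ 2 := by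
    have : (k : ℝ) ≤ k ^ 2 := by exact_mod_cast Nat.le_self_pow two_ne_zero k
    nlinarith [mul_le_mul_of_nonneg_left this (sq_nonneg L)]
  rcases n.eq_zero_or_eq_succ_or_eq_neg_succ with rfl | ⟨k, rfl⟩ | ⟨k, rfl⟩
  · simpa using h₁
  · rw [show ((k : ℤ) + 1).natAbs - 1 = k by omega]
    push_cast
    have := mul_nonneg (mul_nonneg hL hs') (by positivity : (0 : ℝ) ≤ k)
    nlinarith [hk k]
  · rw [show (-((k : ℤ) + 1)).natAbs - 1 = k by omega]
    push_cast
    have := mul_nonneg (mul_nonneg hL hs) (by positivity : (0 : ℝ) ≤ k + 1)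
    have := mul_nonneg (sq_nonneg L) (by positivity : (0 : ℝ) ≤ k)
    nlinarith [hk k]

theorem summable_pow_natAbs_sub_one {r : ℝ} (h₀ : 0 ≤ r) (h₁ : r < 1) :
    Summable fun n : ℤ => r ^ (n.natAbs - 1) := by
  have h : Summable fun n : ℕ => r ^ (n - 1) :=
    (summable_nat_add_iff 1).1 (by simpa using summable_geometric_of_lt_one h₀ h₁)
  exact Summable.of_nat_of_neg (by simpa using h) (by simpa using h)

theorem heatKernel_add_heatKernel_reflect_le {L T t x y : ℝ} (ht : t ∈ Set.Ioc 0 T)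
    (hx : x ∈ Set.Icc 0 L) (hy : y ∈ Set.Icc 0 L) (n : ℤ) :
    heatKernel t (x - y - 2 * n * L) + heatKernel t (x + y - 2 * n * L)
      ≤ 2 * heatKernel t (x - y) * Real.exp (-(L ^ 2 / T)) ^ (n.natAbs - 1) := by
  obtain ⟨hx₀, hxL⟩ := hx
  obtain ⟨hy₀, hyL⟩ := hy
  have hdirect := heatKernel_le_mul_pow ht.1 ht.2
    (sq_add_le_sq_sub_two_mul (abs_le.2 ⟨by linarith, by linarith⟩ : |x - y| ≤ L) n)
  have hreflect := heatKernel_le_mul_pow ht.1 ht.2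
    (sq_add_le_sq_reflect_sub_two_mul
      (abs_le.2 ⟨by linarith, by linarith⟩ : |x - y| ≤ x + y)
      (abs_le.2 ⟨by linarith, by linarith⟩ : |x - y| ≤ 2 * L - (x + y)) n)
  linarith

/-- For every `L > 0`, `T > 0`, the series defining `g(t,x,y)` converges absolutely for
`t ∈ (0,T]` and `x, y ∈ [0,L]`, and there is a constant `C_T > 0` with
`g(t,x,y) ≤ C_T · (4πt)^(−1/2) · exp(−(x−y)²/(4t))` for all such `t, x, y`. -/
theorem greenNeumann_summable_and_bound (L T : ℝ) (hL : 0 < L) (hT : 0 < T) :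
    (∀ t ∈ Set.Ioc (0 : ℝ) T, ∀ x ∈ Set.Icc (0 : ℝ) L, ∀ y ∈ Set.Icc (0 : ℝ) L,
      Summable (fun n : ℤ =>
        |heatKernel t (x - y - 2 * (n : ℝ) * L) + heatKernel t (x + y - 2 * (n : ℝ) * L)|)) ∧
    (∃ C : ℝ, 0 < C ∧ ∀ t ∈ Set.Ioc (0 : ℝ) T, ∀ x ∈ Set.Icc (0 : ℝ) L, ∀ y ∈ Set.Icc (0 : ℝ) L,
      greenNeumann L t x y
        ≤ C * (Real.sqrt (4 * Real.pi * t))⁻¹ * Real.exp (-((x - y) ^ 2) / (4 * t))) := by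
  set r := Real.exp (-(L ^ 2 / T))
  have hr₁ : r < 1 := by
    rw [Real.exp_lt_one_iff, neg_lt_zero]
    positivity
  have hr := summable_pow_natAbs_sub_one (Real.exp_nonneg _) hr₁
  have habs (t x y : ℝ) (ht : t ∈ Set.Ioc 0 T) (hx : x ∈ Set.Icc 0 L) (hy : y ∈ Set.Icc 0 L) :
      Summable (fun n : ℤ =>
        |heatKernel t (x - y - 2 * (n : ℝ) * L) + heatKernel t (x + y - 2 * (n : ℝ) * L)|) := by
    refine Summable.of_nonneg_of_le (fun _ => abs_nonneg _) (fun n => ?_)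
      (hr.mul_left (2 * heatKernel t (x - y)))
    rw [abs_of_nonneg (add_nonneg (heatKernel_nonneg _ _) (heatKernel_nonneg _ _))]
    exact heatKernel_add_heatKernel_reflect_le ht hx hy n
  refine ⟨fun t ht x hx y hy => habs t x y ht hx hy,
    2 * ∑' n : ℤ, r ^ (n.natAbs - 1), ?_, fun t ht x hx y hy => ?_⟩
  · exact mul_pos two_pos (hr.tsum_pos (fun _ => by positivity) 0 (by positivity))
  · calc greenNeumann L t x y
        ≤ ∑' n : ℤ, 2 * heatKernel t (x - y) * r ^ (n.natAbs - 1) :=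
          (habs t x y ht hx hy).of_abs.tsum_le_tsum
            (heatKernel_add_heatKernel_reflect_le ht hx hy) (hr.mul_left _)
      _ = _ := by
          rw [tsum_mul_left, heatKernel]
          ring
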